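/- Fix k ≥ 1 and let W be the k×k symmetric 0–1 matrix whose diagonal entries are 0 and whose off-diagonal entries are all 1 (W = J_k − I_k, where J_k is the all-ones matrix); its spectral measure is μ_W = ((k−1)/k) δ_{−1} + (1/k) δ_{k−1}. Let (A_n)_{n≥1}, (B_n)_{n≥1} be sequences of n×n Hermitian random matrices such that for every real t there is a probability measure ψ(t;·) on ℝ with almost sure convergence in moments of μ_{A_n + tB_n} to ψ(t;·) as n → ∞, where the supports of ψ(t;·) are uniformly bounded for t in compact subsets of ℝ. Let 𝕊_n = I_k ⊗ A_n + W ⊗ B_n be the k×k block matrix with diagonal blocks A_n and all off-diagonal blocks B_n. Then almost surely μ_{𝕊_n} converges weakly as n → ∞ to the probability measure ((k−1)/k) ψ(−1;·) + (1/k) ψ(k−1;·). -/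

import Mathlib

open MeasureTheory ProbabilityTheory Matrix Filter Topology Kronecker
open scoped ENNReal NNReal

noncomputable section

instance matrixMeasurableSpace {m n α : Type*} [MeasurableSpace α] :
    MeasurableSpace (Matrix m n α) :=
  inferInstanceAs (MeasurableSpace (m → n → α))

/-- The (normalized) spectral measure of a matrix: the empirical eigenvalue
distribution if the matrix is Hermitian, the zero measure otherwise. -/
noncomputable def specMeasure {ι : Type*} [Fintype ι] [DecidableEq ι]
    (A : Matrix ι ι ℂ) : Measure ℝ :=
  if h : A.IsHermitian then
    ((Fintype.card ι : ℝ≥0∞))⁻¹ • ∑ i : ι, Measure.dirac (h.eigenvalues i)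
  else 0

/-- The normalized trace `tr_N(M) = trace(M)/N` (real part). -/
noncomputable def ntrace {ι : Type*} [Fintype ι] (M : Matrix ι ι ℂ) : ℝ :=
  (Matrix.trace M).re / (Fintype.card ι)

/-- Weak convergence of a sequence of measures on `ℝ`: convergence of the
integrals of all bounded continuous functions. -/
def WeakLim (μs : ℕ → Measure ℝ) (ν : Measure ℝ) : Prop :=
  ∀ f : BoundedContinuousFunction ℝ ℝ,
    Tendsto (fun n => ∫ x, f x ∂(μs n)) atTop (𝓝 (∫ x, f x ∂ν))

/-- Convergence in moments of a sequence of measures on `ℝ`. -/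
def MomentLim (μs : ℕ → Measure ℝ) (ν : Measure ℝ) : Prop :=
  ∀ m : ℕ, 1 ≤ m →
    Tendsto (fun n => ∫ x, x ^ m ∂(μs n)) atTop (𝓝 (∫ x, x ^ m ∂ν))

open Polynomial in
/-- A bounded continuous function is dominated on all of `ℝ` by a polynomial whose integral against
a compactly supported probability measure is almost the same. -/
lemma exists_polynomial_majorant (ν : Measure ℝ) [IsProbabilityMeasure ν] {M : ℝ} (hM : 0 < M)
    (hν : ∀ᵐ x ∂ν, x ∈ Set.Icc (-M) M) (f : BoundedContinuousFunction ℝ ℝ) {ε : ℝ} (hε : 0 < ε) :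
    ∃ q : ℝ[X], (∀ x, f x ≤ q.eval x) ∧ ∫ x, q.eval x ∂ν ≤ ∫ x, f x ∂ν + ε := by
  set K := M + 1 with hK
  have hK0 : 0 < K := by linarith
  obtain ⟨p, hp⟩ := exists_polynomial_near_of_continuousOn (-K) K f f.continuous.continuousOn
    (ε / 3) (by positivity)
  set S := ∑ i ∈ Finset.range (p.natDegree + 1), |p.coeff i| * K ^ i with hS
  have hS0 : 0 ≤ S := Finset.sum_nonneg fun i _ => by positivity
  set R := ‖f‖ + S with hR
  have hR0 : 0 ≤ R := by positivity
  have hr : M / K < 1 := (div_lt_one hK0).2 (by linarith)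
  have hlim : Tendsto (fun m : ℕ => R * (M / K) ^ m) atTop (𝓝 0) := by
    simpa using (tendsto_pow_atTop_nhds_zero_of_lt_one (by positivity) hr).const_mul R
  obtain ⟨N, hN⟩ := eventually_atTop.1 (hlim.eventually_lt_const (show (0 : ℝ) < ε / 3 by positivity))
  set m := N + p.natDegree with hm
  set q : ℝ[X] := p + C (ε / 3) + C (R * (K⁻¹) ^ (2 * m)) * X ^ (2 * m) with hq
  have hqe : ∀ x, q.eval x = p.eval x + ε / 3 + R * (|x| / K) ^ (2 * m) := by
    intro x
    simp only [hq, eval_add, eval_C, eval_mul, eval_pow, eval_X]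
    rw [div_pow, Even.pow_abs (even_two_mul m), inv_pow]
    ring
  have hle : ∀ x, f x ≤ q.eval x := by
    intro x
    rw [hqe]
    by_cases hx : |x| ≤ K
    · have h1 := abs_lt.1 (hp x (abs_le.1 hx))
      have : 0 ≤ R * (|x| / K) ^ (2 * m) := by positivity
      linarith
    · push Not at hx
      have h1 : 1 ≤ |x| / K := (one_le_div hK0).2 hx.le
      have hpx : |p.eval x| ≤ S * (|x| / K) ^ (2 * m) := by
        rw [eval_eq_sum_range, hS, Finset.sum_mul]
        refine (Finset.abs_sum_le_sum_abs _ _).trans (Finset.sum_le_sum fun i hi => ?_)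
        have hi' : i ≤ 2 * m := by have := Finset.mem_range.1 hi; omega
        calc |p.coeff i * x ^ i| = |p.coeff i| * K ^ i * (|x| / K) ^ i := by
              rw [abs_mul, abs_pow, div_pow]; field_simp
          _ ≤ _ := by gcongr
      have hfx : f x ≤ ‖f‖ * (|x| / K) ^ (2 * m) :=
        ((le_abs_self _).trans (f.norm_coe_le_norm x)).trans
          (le_mul_of_one_le_right (norm_nonneg _) (one_le_pow₀ h1))
      have := (abs_le.1 hpx).1
      rw [hR, add_mul]
      linarith
  refine ⟨q, hle, ?_⟩
  have hae : ∀ᵐ x ∂ν, q.eval x ≤ f x + ε := by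
    filter_upwards [hν] with x hx
    have hxM : |x| ≤ M := abs_le.2 hx
    have h1 := abs_lt.1 (hp x (abs_le.1 (by linarith)))
    have h2 : R * (|x| / K) ^ (2 * m) ≤ R * (M / K) ^ (2 * m) := by gcongr
    have h3 := hN (2 * m) (by omega)
    rw [hqe]
    linarith
  have hf : Integrable f ν := f.integrable ν
  have hfε : Integrable (fun x => f x + ε) ν := hf.add (integrable_const ε)
  have hqi : Integrable (fun x => q.eval x) ν := by
    have hd : Integrable (fun x => q.eval x - f x) ν := by
      refine Integrable.of_bound (C := ε)
        (q.continuous.sub f.continuous).aestronglyMeasurable ?_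
      filter_upwards [hae] with x hx
      rw [Real.norm_eq_abs, abs_of_nonneg (sub_nonneg.2 (hle x))]
      linarith
    exact (hd.add hf).congr (.of_forall fun x => sub_add_cancel _ _)
  calc ∫ x, q.eval x ∂ν ≤ ∫ x, (f x + ε) ∂ν := integral_mono_ae hqi hfε hae
    _ = ∫ x, f x ∂ν + ε := by rw [integral_add hf (integrable_const ε)]; simp

lemma integrable_pow_of_ae_mem_Icc {ν : Measure ℝ} [IsFiniteMeasure ν] {M : ℝ}
    (hν : ∀ᵐ x ∂ν, x ∈ Set.Icc (-M) M) (m : ℕ) : Integrable (fun x : ℝ => x ^ m) ν := by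
  refine Integrable.of_bound (C := M ^ m) (by fun_prop) ?_
  filter_upwards [hν] with x hx
  rw [norm_pow]
  exact pow_le_pow_left₀ (norm_nonneg _) (abs_le.2 hx) m

open Polynomial in
lemma integral_polynomial_eval {μ : Measure ℝ} (h : ∀ m : ℕ, Integrable (fun x : ℝ => x ^ m) μ)
    (q : ℝ[X]) :
    ∫ x, q.eval x ∂μ =
      ∑ i ∈ Finset.range (q.natDegree + 1), q.coeff i * ∫ x, x ^ i ∂μ := by
  simp_rw [eval_eq_sum_range]
  rw [integral_finsetSum _ fun i _ => (h i).const_mul _]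
  simp_rw [integral_const_mul]

open Polynomial in
/-- Convergence in moments to a compactly supported probability measure implies weak
convergence. -/
lemma MomentLim.weakLim {μs : ℕ → Measure ℝ} {ν : Measure ℝ} [IsProbabilityMeasure ν]
    (h : MomentLim μs ν) (hμ : ∀ᶠ n in atTop, IsProbabilityMeasure (μs n))
    (hint : ∀ n m, Integrable (fun x : ℝ => x ^ m) (μs n)) {M : ℝ} (hM : 0 < M)
    (hν : ∀ᵐ x ∂ν, x ∈ Set.Icc (-M) M) : WeakLim μs ν := by
  have hpoly : ∀ q : ℝ[X],
      Tendsto (fun n => ∫ x, q.eval x ∂(μs n)) atTop (𝓝 (∫ x, q.eval x ∂ν)) := by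
    intro q
    simp_rw [integral_polynomial_eval (hint _),
      integral_polynomial_eval (integrable_pow_of_ae_mem_Icc hν)]
    refine tendsto_finsetSum _ fun i _ => Tendsto.const_mul _ ?_
    rcases Nat.eq_zero_or_pos i with rfl | hi
    · refine tendsto_const_nhds.congr' ?_
      filter_upwards [hμ] with n hn
      simp
    · exact h i hi
  have hupper : ∀ f : BoundedContinuousFunction ℝ ℝ, ∀ b, ∫ x, f x ∂ν < b →
      ∀ᶠ n in atTop, ∫ x, f x ∂(μs n) < b := by
    intro f b hb
    obtain ⟨q, hq, hqν⟩ := exists_polynomial_majorant ν hM hν f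
      (half_pos (sub_pos.2 hb))
    filter_upwards [hμ, (hpoly q).eventually_lt_const (show _ < b by linarith)] with n hn hlt
    refine lt_of_le_of_lt (integral_mono (f.integrable _) ?_ hq) hlt
    simp_rw [eval_eq_sum_range]
    exact integrable_finsetSum _ fun i _ => (hint n i).const_mul _
  intro f
  refine tendsto_order.2 ⟨fun a ha => ?_, hupper f⟩
  have := hupper (-f) (-a) (by simpa [integral_neg] using ha)
  simpa [integral_neg] using this

lemma Matrix.IsHermitian.trace_pow_eq_sum_eigenvalues {ι : Type*} [Fintype ι] [DecidableEq ι]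
    {A : Matrix ι ι ℂ} (hA : A.IsHermitian) (m : ℕ) :
    (A ^ m).trace = ∑ i, (hA.eigenvalues i : ℂ) ^ m := by
  conv_lhs => rw [hA.spectral_theorem, ← map_pow, Unitary.conjStarAlgAut_apply, trace_mul_comm,
    ← mul_assoc, Unitary.coe_star_mul_self, one_mul, diagonal_pow]
  simp [trace_diagonal]

section specMeasure

variable {ι : Type*} [Fintype ι] [DecidableEq ι] (A : Matrix ι ι ℂ)

lemma integrable_specMeasure (f : ℝ → ℝ) : Integrable f (specMeasure A) := by
  unfold specMeasure
  split_ifs with h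
  · rcases isEmpty_or_nonempty ι with hι | hι
    · simp
    · refine Integrable.smul_measure ?_ (by simp)
      exact integrable_finsetSum_measure.2 fun i _ => integrable_dirac (by simp)
  · exact integrable_zero_measure

variable {A}

lemma isProbabilityMeasure_specMeasure [Nonempty ι] (hA : A.IsHermitian) :
    IsProbabilityMeasure (specMeasure A) := by
  constructor
  rw [specMeasure, dif_pos hA]
  simp [ENNReal.inv_mul_cancel]

lemma integral_pow_specMeasure (hA : A.IsHermitian) (m : ℕ) :
    ∫ x, x ^ m ∂(specMeasure A) = ntrace (A ^ m) := by
  rw [specMeasure, dif_pos hA, integral_smul_measure,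
    integral_finsetSum_measure fun i _ => integrable_dirac (by simp), ntrace,
    hA.trace_pow_eq_sum_eigenvalues]
  simp only [integral_dirac, ENNReal.toReal_inv, ENNReal.toReal_natCast, smul_eq_mul]
  norm_cast
  rw [div_eq_inv_mul]

end specMeasure

/-- Powers of `P ⊗ X + (1 - P) ⊗ Y` for an idempotent `P`. -/
lemma kronecker_idempotent_add_pow {κ ι : Type*} [Fintype κ] [DecidableEq κ] [Fintype ι]
    [DecidableEq ι] {P : Matrix κ κ ℂ} (hP : P * P = P) (X Y : Matrix ι ι ℂ) (m : ℕ) :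
    (P ⊗ₖ X + (1 - P) ⊗ₖ Y) ^ m = P ⊗ₖ (X ^ m) + (1 - P) ⊗ₖ (Y ^ m) := by
  induction m with
  | zero => rw [pow_zero, pow_zero, pow_zero, ← add_kronecker]; simp
  | succ m ih =>
    rw [pow_succ, ih]
    simp only [add_mul, mul_add, ← mul_kronecker_mul, mul_sub, sub_mul, hP, mul_one, one_mul,
      sub_self, zero_kronecker, ← pow_succ, sub_zero, add_zero, zero_add]

/-- The normalized trace of a power of `I ⊗ A + (J - I) ⊗ B`. -/
lemma ntrace_pow_one_kronecker_add {k : ℕ} (hk : 1 ≤ k) {ι : Type*} [Fintype ι] [DecidableEq ι]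
    (A B : Matrix ι ι ℂ) (m : ℕ) :
    ntrace (((1 : Matrix (Fin k) (Fin k) ℂ) ⊗ₖ A +
        (Matrix.of fun i j : Fin k => if i = j then (0 : ℂ) else 1) ⊗ₖ B) ^ m) =
      ((k : ℝ) - 1) / k * ntrace ((A + ((-1 : ℝ) : ℂ) • B) ^ m)
        + 1 / k * ntrace ((A + (((k : ℝ) - 1 : ℝ) : ℂ) • B) ^ m) := by
  have hk0 : (k : ℂ) ≠ 0 := by exact_mod_cast (by omega : k ≠ 0)
  set P : Matrix (Fin k) (Fin k) ℂ := Matrix.of fun _ _ => (k : ℂ)⁻¹ with hPdef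
  have hP : P * P = P := by
    ext i j
    simp [hPdef, mul_apply, hk0]
  have htr : P.trace = 1 := by simp [hPdef, trace, hk0]
  have hdecomp : (1 : Matrix (Fin k) (Fin k) ℂ) ⊗ₖ A +
        (Matrix.of fun i j : Fin k => if i = j then (0 : ℂ) else 1) ⊗ₖ B =
      P ⊗ₖ (A + (((k : ℝ) - 1 : ℝ) : ℂ) • B) + (1 - P) ⊗ₖ (A + ((-1 : ℝ) : ℂ) • B) := by
    ext ⟨i, a⟩ ⟨j, b⟩
    by_cases hij : i = j <;> simp [hPdef, hij] <;> field_simp <;> ring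
  rw [hdecomp, kronecker_idempotent_add_pow hP]
  simp only [ntrace, trace_add, trace_kronecker, trace_sub, htr, trace_one, Fintype.card_prod,
    Fintype.card_fin, one_mul, Complex.add_re]
  have : ((k : ℂ) - 1) = (((k : ℝ) - 1 : ℝ) : ℂ) := by push_cast; rfl
  rw [this, Complex.re_ofReal_mul]
  push_cast
  ring

lemma isHermitian_add_ofReal_smul {ι : Type*} {A B : Matrix ι ι ℂ} (hA : A.IsHermitian)
    (hB : B.IsHermitian) (t : ℝ) : (A + (t : ℂ) • B).IsHermitian := by
  simp [Matrix.IsHermitian, conjTranspose_add, conjTranspose_smul, hA.eq, hB.eq]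

lemma isHermitian_kronecker {κ ι : Type*} {A : Matrix κ κ ℂ} {B : Matrix ι ι ℂ}
    (hA : A.IsHermitian) (hB : B.IsHermitian) : (A ⊗ₖ B).IsHermitian := by
  rw [Matrix.IsHermitian, conjTranspose_kronecker, hA.eq, hB.eq]

/-- Fix `k ≥ 1` and let `W = J_k - I_k` be the `k × k` matrix
with `0` on the diagonal and `1` elsewhere. Let `A_n, B_n` be Hermitian random
matrices of order `n` such that for every real `t`, almost surely the spectral
measures of `A_n + t B_n` converge in moments to a probability measure `ψ t`,
with supports uniformly bounded for `t` in compact sets. Then the spectral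
measures of the block matrix `𝕊_n = I_k ⊗ A_n + W ⊗ B_n` (diagonal blocks
`A_n`, off-diagonal blocks `B_n`) converge weakly, almost surely, to
`((k-1)/k) ψ(-1) + (1/k) ψ(k-1)`. -/
theorem blockMatrix_offdiagonal_ones_limit
    {Ω : Type*} [MeasurableSpace Ω] (P : Measure Ω) [IsProbabilityMeasure P]
    {k : ℕ} (hk : 1 ≤ k)
    (A B : (n : ℕ) → Ω → Matrix (Fin n) (Fin n) ℂ)
    (hAherm : ∀ n ω, (A n ω).IsHermitian)
    (hBherm : ∀ n ω, (B n ω).IsHermitian)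
    (ψ : ℝ → Measure ℝ) (hψprob : ∀ t, IsProbabilityMeasure (ψ t))
    (hψ : ∀ t : ℝ, ∀ᵐ ω ∂P,
      MomentLim (fun n => specMeasure (A n ω + (t : ℂ) • B n ω)) (ψ t))
    (hψunif : ∀ C : Set ℝ, IsCompact C →
      ∃ M : ℝ, 0 < M ∧ ∀ t ∈ C, ψ t (Set.Icc (-M) M) = 1)
    (W : Matrix (Fin k) (Fin k) ℂ)
    (hW : W = Matrix.of fun i j => if i = j then 0 else 1) :
    ∀ᵐ ω ∂P,
      WeakLim
        (fun n => specMeasure ((1 : Matrix (Fin k) (Fin k) ℂ) ⊗ₖ A n ω + W ⊗ₖ B n ω))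
        (ENNReal.ofReal (((k : ℝ) - 1) / k) • ψ (-1)
          + ENNReal.ofReal ((1 : ℝ) / k) • ψ ((k : ℝ) - 1)) := by
  subst hW
  have hk0 : (0 : ℝ) < k := by exact_mod_cast hk
  have hk1 : (1 : ℝ) ≤ k := by exact_mod_cast hk
  obtain ⟨M, hM, hsupp⟩ := hψunif {-1, (k : ℝ) - 1} (Set.toFinite _).isCompact
  have hae : ∀ t ∈ ({-1, (k : ℝ) - 1} : Set ℝ), ∀ᵐ x ∂(ψ t), x ∈ Set.Icc (-M) M := fun t ht =>
    have := hψprob t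
    (mem_ae_iff_prob_eq_one measurableSet_Icc).2 (hsupp t ht)
  have hae₁ := hae (-1) (by simp)
  have hae₂ := hae ((k : ℝ) - 1) (by simp)
  have hp₁ := hψprob (-1)
  have hp₂ := hψprob ((k : ℝ) - 1)
  have ha : 0 ≤ ((k : ℝ) - 1) / k := div_nonneg (by linarith) hk0.le
  have hb : 0 ≤ (1 : ℝ) / k := by positivity
  set ν := ENNReal.ofReal (((k : ℝ) - 1) / k) • ψ (-1)
    + ENNReal.ofReal ((1 : ℝ) / k) • ψ ((k : ℝ) - 1) with hν
  have hνprob : IsProbabilityMeasure ν := by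
    constructor
    simp only [hν, Measure.add_apply, Measure.smul_apply, measure_univ, smul_eq_mul, mul_one]
    rw [← ENNReal.ofReal_add ha hb, ← add_div, sub_add_cancel, div_self hk0.ne',
      ENNReal.ofReal_one]
  have hνae : ∀ᵐ x ∂ν, x ∈ Set.Icc (-M) M :=
    ae_add_measure_iff.2 ⟨Measure.ae_smul_measure hae₁ _, Measure.ae_smul_measure hae₂ _⟩
  have hνint : ∀ m : ℕ, ∫ x, x ^ m ∂ν =
      ((k : ℝ) - 1) / k * ∫ x, x ^ m ∂(ψ (-1)) + 1 / k * ∫ x, x ^ m ∂(ψ ((k : ℝ) - 1)) := by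
    intro m
    rw [hν, integral_add_measure
      ((integrable_pow_of_ae_mem_Icc hae₁ m).smul_measure ENNReal.ofReal_ne_top)
      ((integrable_pow_of_ae_mem_Icc hae₂ m).smul_measure ENNReal.ofReal_ne_top),
      integral_smul_measure, integral_smul_measure, ENNReal.toReal_ofReal ha,
      ENNReal.toReal_ofReal hb, smul_eq_mul, smul_eq_mul]
  have hWherm : (Matrix.of fun i j : Fin k => if i = j then (0 : ℂ) else 1).IsHermitian := by
    ext i j
    by_cases hij : i = j <;> simp [hij, eq_comm]
  filter_upwards [hψ (-1), hψ ((k : ℝ) - 1)] with ω h₁ h₂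
  have hherm := fun n => (isHermitian_kronecker isHermitian_one (hAherm n ω)).add
    (isHermitian_kronecker hWherm (hBherm n ω))
  refine MomentLim.weakLim (fun m hm => ?_) ?_ (fun n m => integrable_specMeasure _ _) hM hνae
  · rw [hνint]
    refine (((h₁ m hm).const_mul _).add ((h₂ m hm).const_mul _)).congr fun n => ?_
    rw [integral_pow_specMeasure (hherm n), ntrace_pow_one_kronecker_add hk,
      integral_pow_specMeasure (isHermitian_add_ofReal_smul (hAherm n ω) (hBherm n ω) _),
      integral_pow_specMeasure (isHermitian_add_ofReal_smul (hAherm n ω) (hBherm n ω) _)]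
  · filter_upwards [eventually_ge_atTop 1] with n hn
    have : Nonempty (Fin k) := ⟨⟨0, hk⟩⟩
    have : Nonempty (Fin n) := ⟨⟨0, hn⟩⟩
    exact isProbabilityMeasure_specMeasure (hherm n)
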